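/- Let r ≥ 1 and let n_1, …, n_r ≥ 2 be pairwise coprime integers and m_1, …, m_r ∈ ℤ such that for every nonempty subset I ⊆ {1,…,r} the pair (∏_{i∈I} n_i, |∑_{i∈I} m_i|) is coprime. Write [n(I)] := ∏_{i∈I} n_i (with [n(∅)] = 1) and |m(J)| := ∑_{j∈J} m_j (with |m(∅)| = 0). Then for every q ∈ ℂ with q ≠ 0 and every s ∈ ℂ such that 1 − q^{|m(J)|·[n(I)]} s^{[n(I)]} ≠ 0 for all pairs of subsets I ⊆ J ⊆ {1,…,r}, the function Z_q(s; σ_{n_1,m_1}, …, σ_{n_r,m_r}) := det(I_{n_1⋯n_r} − s · T_{n_1,m_1} ⊗ ⋯ ⊗ T_{n_r,m_r})^{−1} satisfies Z_q(s; σ_{n_1,m_1}, …, σ_{n_r,m_r}) = ∏_{I ⊆ J ⊆ {1,…,r}} (1 − q^{|m(J)|·[n(I)]} s^{[n(I)]})^{(−1)^{|J|−|I|+1}}, the product running over all pairs of subsets I ⊆ J (including I = ∅) with integer exponents (−1)^{|J|−|I|+1}. Equivalently, Z_q(s; σ_{n_1,m_1}, …, σ_{n_r,m_r}) = ∏_{∅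 ≠ I ⊆ J ⊆ {1,…,r}} ζ(s, σ_{[n(I)], |m(J)|}; β_{[n(I)],q})^{(−1)^{|J|−|I|}}, where ζ(s, σ_{N,M}; β_{N,q}) = (1 − q^M s)/((1 − s)(1 − q^{NM}s^N)) is the torus braid zeta function. -/

import Mathlib

open Matrix

/-- The (unreduced) Burau matrix `B_{i+1} = I_i ⊕ [[1−q, 1], [q, 0]] ⊕ I_{n-i-2}`
(the 2×2 block sits in rows/columns `i`, `i+1`, zero-based). -/
noncomputable def burauMatrix (n : ℕ) (q : ℂ) (i : Fin (n - 1)) :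
    Matrix (Fin n) (Fin n) ℂ := fun j k =>
  if (j : ℕ) = i ∧ (k : ℕ) = i then 1 - q
  else if (j : ℕ) = i ∧ (k : ℕ) = (i : ℕ) + 1 then 1
  else if (j : ℕ) = (i : ℕ) + 1 ∧ (k : ℕ) = i then q
  else if (j : ℕ) = (i : ℕ) + 1 ∧ (k : ℕ) = (i : ℕ) + 1 then 0
  else if j = k then 1 else 0

/-- The reduced Burau matrix `B^r_{i+1}` (zero-based generator index `i`): it agrees
with the identity except in row `i`, where the entries at columns `i−1, i, i+1`
are `q, −q, 1` respectively. -/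
noncomputable def rBurauMatrix (n : ℕ) (q : ℂ) (i : Fin (n - 1)) :
    Matrix (Fin (n - 1)) (Fin (n - 1)) ℂ := fun j k =>
  if (j : ℕ) = i then
    if (k : ℕ) + 1 = i then q
    else if (k : ℕ) = i then -q
    else if (k : ℕ) = (i : ℕ) + 1 then 1
    else 0
  else if j = k then 1 else 0


/-- The Burau image `B_1 B_2 ⋯ B_{n−1}` of the braid `σ_1 σ_2 ⋯ σ_{n−1}`. -/
noncomputable def burauProd (n : ℕ) (q : ℂ) : Matrix (Fin n) (Fin n) ℂ :=
  ((List.finRange (n - 1)).map (burauMatrix n q)).prod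

/-- The torus type braid matrix `T_{N,M} = (B_1 ⋯ B_{N−1})^M`. -/
noncomputable def torusBurau (N : ℕ) (q : ℂ) (M : ℤ) : Matrix (Fin N) (Fin N) ℂ :=
  burauProd N q ^ M

/-- The Kronecker tensor product `T_{n_1,m_1} ⊗ ⋯ ⊗ T_{n_r,m_r}`, realized as a matrix
indexed by `Π i, Fin (n i)` with entries `∏ i, T_{n i, m i} (v i) (w i)`. -/
noncomputable def torusKronecker {r : ℕ} (n : Fin r → ℕ) (q : ℂ) (m : Fin r → ℤ) :
    Matrix (∀ i, Fin (n i)) (∀ i, Fin (n i)) ℂ :=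
  fun v w => ∏ i, torusBurau (n i) q (m i) (v i) (w i)


/-- The Burau generator indexed by a natural number. -/
noncomputable def bNat (n : ℕ) (q : ℂ) (i : ℕ) :
    Matrix (Fin n) (Fin n) ℂ := fun j k =>
  if (j : ℕ) = i ∧ (k : ℕ) = i then 1 - q
  else if (j : ℕ) = i ∧ (k : ℕ) = (i : ℕ) + 1 then 1
  else if (j : ℕ) = (i : ℕ) + 1 ∧ (k : ℕ) = i then q
  else if (j : ℕ) = (i : ℕ) + 1 ∧ (k : ℕ) = (i : ℕ) + 1 then 0
  else if j = k then 1 else 0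

lemma burauProd_eq_range (n : ℕ) (q : ℂ) :
    burauProd n q = ((List.range (n - 1)).map (bNat n q)).prod := by
  rw [← List.map_coe_finRange_eq_range, List.map_map]
  rfl

lemma bNat_range_prod (n : ℕ) (q : ℂ) (k : ℕ) (hk : k + 1 ≤ n) (i j : Fin n) :
    ((List.range k).map (bNat n q)).prod i j =
      if (i : ℕ) = 0 then (if (j : ℕ) < k then 1 - q else if (j : ℕ) = k then 1 else 0)
      else if (i : ℕ) ≤ k then (if (j : ℕ) + 1 = i then q else 0)
      else if i = j then 1 else 0 := by
  induction k generalizing i j with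
  | zero =>
    simp only [List.range_zero, List.map_nil, List.prod_nil, Matrix.one_apply, Fin.ext_iff]
    grind
  | succ k ih =>
    rw [List.range_succ, List.map_append, List.prod_append, List.map_singleton,
      List.prod_singleton, Matrix.mul_apply]
    have key : ∀ l : Fin n, bNat n q k l j =
        (if (⟨k, by omega⟩ : Fin n) = l then
            (if (j : ℕ) = k then 1 - q else if (j : ℕ) = k + 1 then 1 else 0) else 0) +
        (if (⟨k + 1, by omega⟩ : Fin n) = l then (if (j : ℕ) = k then q else 0) else 0) +
        (if j = l then (if (j : ℕ) = k ∨ (j : ℕ) = k + 1 then 0 else 1) else 0) := by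
      intro l
      simp only [bNat, Fin.ext_iff]
      grind
    simp only [key, mul_add, Finset.sum_add_distrib, mul_ite, mul_zero, Finset.sum_ite_eq,
      Finset.mem_univ, if_true]
    simp only [ih (by omega), Fin.ext_iff]
    clear key ih
    grind

lemma burauProd_apply (n : ℕ) (hn : 2 ≤ n) (q : ℂ) (i j : Fin n) :
    burauProd n q i j =
      if (i : ℕ) = 0 then (if (j : ℕ) + 1 = n then 1 else 1 - q)
      else (if (j : ℕ) + 1 = i then q else 0) := by
  rw [burauProd_eq_range, bNat_range_prod _ _ _ (by omega)]
  have := i.2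
  have := j.2
  grind

/-- Fourier matrix. -/
noncomputable def fourierM (n : ℕ) (w : ℂ) : Matrix (Fin n) (Fin n) ℂ :=
  fun i j => (w ^ (j : ℕ)) ^ (i : ℕ)

/-- Lower triangular form of the Burau matrix. -/
noncomputable def triM (n : ℕ) (q w : ℂ) : Matrix (Fin n) (Fin n) ℂ :=
  fun l j => if (j : ℕ) = 0 then (if (l : ℕ) = 0 then 1 else 1 - q)
    else if j = l then q * (w ^ (j : ℕ))⁻¹ else 0

lemma fourierM_det (n : ℕ) (w : ℂ) (hw : IsPrimitiveRoot w n) : IsUnit (fourierM n w).det := by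
  have : fourierM n w = (Matrix.vandermonde (fun j : Fin n => w ^ (j : ℕ)))ᵀ := by
    ext i j; simp [fourierM, Matrix.vandermonde]
  rw [this, Matrix.det_transpose, isUnit_iff_ne_zero, Matrix.det_vandermonde_ne_zero_iff]
  intro a b h
  exact Fin.ext (hw.pow_inj a.2 b.2 h)

lemma sum_pow_root (n : ℕ) (w : ℂ) (hw : IsPrimitiveRoot w n) (j : ℕ) (hj : j < n) :
    ∑ i ∈ Finset.range n, (w ^ j) ^ i = if j = 0 then (n : ℂ) else 0 := by
  split_ifs with h
  · simp [h]
  · have h1 : w ^ j ≠ 1 := hw.pow_ne_one_of_pos_of_lt h hj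
    rw [geom_sum_eq h1, ← pow_mul, mul_comm, pow_mul, hw.pow_eq_one]
    simp

lemma burau_conj (n : ℕ) (hn : 2 ≤ n) (q w : ℂ) (hw : IsPrimitiveRoot w n) :
    burauProd n q * fourierM n w = fourierM n w * triM n q w := by
  have hw0 : w ≠ 0 := hw.ne_zero (by omega)
  ext i j
  rw [Matrix.mul_apply, Matrix.mul_apply]
  have hL : ∑ l, burauProd n q i l * fourierM n w l j =
      if (i : ℕ) = 0 then (1 - q) * (∑ l ∈ Finset.range n, (w ^ (j : ℕ)) ^ l)
        + q * (w ^ (j : ℕ)) ^ (n - 1)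
      else q * (w ^ (j : ℕ)) ^ ((i : ℕ) - 1) := by
    split_ifs with h
    · rw [← Fin.sum_univ_eq_sum_range, Finset.mul_sum]
      have : ∀ l : Fin n, burauProd n q i l * fourierM n w l j =
          (1 - q) * (w ^ (j : ℕ)) ^ (l : ℕ) +
            (if (⟨n - 1, by omega⟩ : Fin n) = l then q * (w ^ (j : ℕ)) ^ (l : ℕ) else 0) := by
        intro l
        rw [burauProd_apply n hn, if_pos h, fourierM]
        simp only [Fin.ext_iff]
        split_ifs <;> first | omega | ring
      simp only [this, Finset.sum_add_distrib, Finset.sum_ite_eq, Finset.mem_univ, if_true]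
    · have : ∀ l : Fin n, burauProd n q i l * fourierM n w l j =
            (if (⟨i - 1, by omega⟩ : Fin n) = l then q * (w ^ (j : ℕ)) ^ (l : ℕ) else 0) := by
        intro l
        rw [burauProd_apply n hn, if_neg h, fourierM]
        simp only [Fin.ext_iff]
        split_ifs <;> first | omega | ring
      simp only [this, Finset.sum_ite_eq, Finset.mem_univ, if_true]
  rw [hL, sum_pow_root n w hw j j.2]
  by_cases hj : (j : ℕ) = 0
  · have : ∀ l : Fin n, fourierM n w i l * triM n q w l j =
        (1 - q) * (w ^ (i : ℕ)) ^ (l : ℕ) +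
          (if (⟨0, by omega⟩ : Fin n) = l then q else 0) := by
      intro l
      rw [fourierM, triM, if_pos hj, ← pow_mul, ← pow_mul, mul_comm (l : ℕ)]
      simp only [Fin.ext_iff]
      split_ifs with h1 h2
      · rw [h1]; ring
      · omega
      · omega
      · ring
    simp only [this, Finset.sum_add_distrib, Finset.sum_ite_eq, Finset.mem_univ, if_true]
    rw [← Finset.mul_sum, Fin.sum_univ_eq_sum_range (fun l => (w ^ (i : ℕ)) ^ l),
      sum_pow_root n w hw i i.2, hj]
    split_ifs <;> simp_all
  · have : ∀ l : Fin n, fourierM n w i l * triM n q w l j =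
        (if j = l then (w ^ (j : ℕ)) ^ (i : ℕ) * (q * (w ^ (j : ℕ))⁻¹) else 0) := by
      intro l
      rw [fourierM, triM, if_neg hj]
      split_ifs with h1
      · rw [h1]
      · simp
    simp only [this, Finset.sum_ite_eq, Finset.mem_univ, if_true, if_neg hj]
    have hx : w ^ (j : ℕ) ≠ 0 := pow_ne_zero _ hw0
    have hxn : (w ^ (j : ℕ)) ^ n = 1 := by
      rw [← pow_mul, mul_comm, pow_mul, hw.pow_eq_one, one_pow]
    generalize w ^ (j : ℕ) = x at *
    split_ifs with h
    · rw [h, pow_sub₀ x hx (by omega : 1 ≤ n), hxn]; simp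
    · rw [pow_sub₀ x hx (by omega : 1 ≤ (i : ℕ))]; ring

lemma lower_mul_diag {n : ℕ} (A B : Matrix (Fin n) (Fin n) ℂ)
    (hA : A.BlockTriangular OrderDual.toDual) (hB : B.BlockTriangular OrderDual.toDual)
    (i : Fin n) : (A * B) i i = A i i * B i i := by
  rw [Matrix.mul_apply, Finset.sum_eq_single i]
  · intro j _ hj
    rcases lt_or_gt_of_ne hj with h | h
    · rw [hB (i := j) (j := i) (by simpa using h), mul_zero]
    · rw [hA (i := i) (j := j) (by simpa using h), zero_mul]
  · simp

lemma lower_pow_diag {n : ℕ} (A : Matrix (Fin n) (Fin n) ℂ)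
    (hA : A.BlockTriangular OrderDual.toDual) (k : ℕ) (i : Fin n) :
    (A ^ k) i i = A i i ^ k := by
  induction k with
  | zero => simp
  | succ k ih => rw [pow_succ, lower_mul_diag _ _ (hA.pow k) hA, ih, pow_succ]

lemma lower_zpow {n : ℕ} (A : Matrix (Fin n) (Fin n) ℂ)
    (hA : A.BlockTriangular OrderDual.toDual) (hu : IsUnit A.det) (k : ℤ) :
    (A ^ k).BlockTriangular OrderDual.toDual ∧ ∀ i, (A ^ k) i i = A i i ^ k := by
  obtain ⟨k, rfl | rfl⟩ := k.eq_nat_or_neg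
  · rw [zpow_natCast]
    exact ⟨hA.pow k, fun i => by rw [lower_pow_diag A hA, zpow_natCast]⟩
  · rw [Matrix.zpow_neg_natCast]
    have hu' : IsUnit (A ^ k).det := by rw [Matrix.det_pow]; exact hu.pow k
    have hinv : ((A ^ k)⁻¹).BlockTriangular OrderDual.toDual := by
      have := Matrix.invertibleOfIsUnitDet _ hu'
      exact Matrix.blockTriangular_inv_of_blockTriangular (hA.pow k)
    refine ⟨hinv, fun i => ?_⟩
    have h := lower_mul_diag _ _ (hA.pow k) hinv i
    rw [Matrix.mul_nonsing_inv _ hu', Matrix.one_apply_eq, lower_pow_diag A hA] at h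
    rw [_root_.zpow_neg, zpow_natCast]
    exact eq_inv_of_mul_eq_one_right h.symm

lemma triM_lower (n : ℕ) (q w : ℂ) : (triM n q w).BlockTriangular OrderDual.toDual := by
  intro i j h
  have h : i < j := by simpa using h
  simp only [triM]
  rw [if_neg, if_neg]
  · exact h.ne'
  · have : (i : ℕ) < j := h
    omega

lemma triM_diag (n : ℕ) (q w : ℂ) (i : Fin n) :
    triM n q w i i = if (i : ℕ) = 0 then 1 else q * (w ^ (i : ℕ))⁻¹ := by
  simp only [triM]
  split_ifs <;> rfl

lemma triM_det (n : ℕ) (q w : ℂ) (hq : q ≠ 0) (hw : w ≠ 0) : IsUnit (triM n q w).det := by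
  rw [Matrix.det_of_isLowerTriangular _ (triM_lower n q w), isUnit_iff_ne_zero,
    Finset.prod_ne_zero_iff]
  intro i _
  rw [triM_diag]
  split_ifs
  · simp
  · simp [hq, hw]

lemma torus_conj (n : ℕ) (hn : 2 ≤ n) (q w : ℂ) (hq : q ≠ 0) (hw : IsPrimitiveRoot w n)
    (m : ℤ) :
    torusBurau n q m * fourierM n w = fourierM n w * (triM n q w) ^ m := by
  have hV := fourierM_det n w hw
  have hU := triM_det n q w hq (hw.ne_zero (by omega))
  have h := burau_conj n hn q w hw
  have hB : IsUnit (burauProd n q).det := by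
    have := congrArg Matrix.det h
    rw [Matrix.det_mul, Matrix.det_mul, mul_comm] at this
    rw [hV.mul_left_cancel this]
    exact hU
  exact (Matrix.SemiconjBy.zpow_right hU hB (show SemiconjBy _ _ _ from h.symm) m).symm

/-- Kronecker product of a family of matrices. -/
noncomputable def kronM {r : ℕ} {n : Fin r → ℕ} (A : ∀ i, Matrix (Fin (n i)) (Fin (n i)) ℂ) :
    Matrix (∀ i, Fin (n i)) (∀ i, Fin (n i)) ℂ :=
  fun v w => ∏ i, A i (v i) (w i)

lemma kronM_mul {r : ℕ} {n : Fin r → ℕ} (A B : ∀ i, Matrix (Fin (n i)) (Fin (n i)) ℂ) :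
    kronM A * kronM B = kronM (fun i => A i * B i) := by
  ext v w
  simp only [kronM, Matrix.mul_apply, ← Finset.prod_mul_distrib]
  rw [Finset.prod_univ_sum, Fintype.piFinset_univ]

lemma kronM_one {r : ℕ} {n : Fin r → ℕ} :
    kronM (fun i => (1 : Matrix (Fin (n i)) (Fin (n i)) ℂ)) = 1 := by
  ext v w
  simp only [kronM, Matrix.one_apply, funext_iff]
  by_cases h : ∀ i, v i = w i
  · simp [h]
  · rw [if_neg h]
    push Not at h
    obtain ⟨i, hi⟩ := h
    exact Finset.prod_eq_zero (Finset.mem_univ i) (if_neg hi)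

lemma det_kron_conj {r : ℕ} {n : Fin r → ℕ} (A V U : ∀ i, Matrix (Fin (n i)) (Fin (n i)) ℂ)
    (hV : ∀ i, IsUnit (V i).det) (h : ∀ i, A i * V i = V i * U i) (s : ℂ) :
    (1 - s • kronM A).det = (1 - s • kronM U).det := by
  have h1 : kronM V * kronM (fun i => (V i)⁻¹) = 1 := by
    rw [kronM_mul, ← kronM_one]
    congr 1; ext1 i
    exact Matrix.mul_nonsing_inv _ (hV i)
  have h2 : kronM A * kronM V = kronM V * kronM U := by
    rw [kronM_mul, kronM_mul]
    congr 1; ext1 i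
    exact h i
  have h3 : (1 - s • kronM A) * kronM V = kronM V * (1 - s • kronM U) := by
    rw [sub_mul, mul_sub, one_mul, mul_one, smul_mul_assoc, mul_smul_comm, h2]
  have h4 := congrArg Matrix.det h3
  rw [Matrix.det_mul, Matrix.det_mul, mul_comm] at h4
  have h5 : (kronM V).det ≠ 0 := by
    intro h0
    have := congrArg Matrix.det h1
    rw [Matrix.det_mul, h0, zero_mul, Matrix.det_one] at this
    exact zero_ne_one this
  exact mul_left_cancel₀ h5 h4

lemma det_kron_lower {r : ℕ} {n : Fin r → ℕ} (U : ∀ i, Matrix (Fin (n i)) (Fin (n i)) ℂ)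
    (hU : ∀ i, (U i).BlockTriangular OrderDual.toDual) (s : ℂ) :
    (1 - s • kronM U).det = ∏ v : ∀ i, Fin (n i), (1 - s * ∏ i, U i (v i) (v i)) := by
  rw [← Matrix.det_submatrix_equiv_self (ofLex : Lex (∀ i, Fin (n i)) ≃ _)]
  rw [Matrix.det_of_isLowerTriangular]
  · refine Fintype.prod_equiv ofLex _ _ fun v => ?_
    simp [kronM]
  · intro v w hvw
    have hvw : v < w := OrderDual.toDual_lt_toDual.mp hvw
    have hne : ofLex v ≠ ofLex w := fun h => hvw.ne (ofLex.injective h)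
    simp only [Matrix.submatrix_apply, Matrix.sub_apply, Matrix.one_apply_ne hne,
      Matrix.smul_apply, kronM]
    have : ∃ i, ofLex v i < ofLex w i := by
      by_contra hc
      push Not at hc
      exact absurd (Pi.toLex_monotone (show ofLex w ≤ ofLex v from hc)) (not_le.mpr hvw)
    obtain ⟨i, hi⟩ := this
    rw [Finset.prod_eq_zero (Finset.mem_univ i) (hU i (by simpa using hi))]
    simp

lemma mobius_prod {ι : Type*} [DecidableEq ι] (J : Finset ι) (G : Finset ι → ℂ)
    (hG : ∀ K ⊆ J, G K ≠ 0) :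
    ∏ I ∈ J.powerset, (∏ K ∈ I.powerset, G K) ^ ((-1 : ℤ) ^ (J.card - I.card + 1))
      = (G J)⁻¹ := by
  induction J using Finset.induction_on generalizing G with
  | empty => simp
  | insert a J ha ih =>
    rw [Finset.prod_powerset_insert ha, ← Finset.prod_mul_distrib,
      ← ih (fun K => G (insert a K)) (fun K hK => hG _ (Finset.insert_subset_insert a hK))]
    refine Finset.prod_congr rfl fun I hI => ?_
    have hI := Finset.mem_powerset.mp hI
    have haI : a ∉ I := fun h => ha (hI h)
    have hc := Finset.card_le_card hI
    rw [Finset.prod_powerset_insert haI, Finset.card_insert_of_notMem ha,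
      Finset.card_insert_of_notMem haI, mul_zpow, ← mul_assoc,
      show J.card + 1 - I.card + 1 = (J.card - I.card + 1) + 1 by omega,
      show J.card + 1 - (I.card + 1) + 1 = (J.card - I.card + 1) by omega, pow_succ,
      mul_neg_one, _root_.zpow_neg, inv_mul_cancel₀, one_mul]
    apply zpow_ne_zero
    rw [Finset.prod_ne_zero_iff]
    intro K hK
    exact hG K (((Finset.mem_powerset.mp hK).trans hI).trans (Finset.subset_insert a J))

lemma prod_root (n : ℕ) (hn : 0 < n) (z : ℂ) (hz : IsPrimitiveRoot z n) (x : ℂ) :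
    ∏ j : Fin n, (1 - x * z ^ (j : ℕ)) = 1 - x ^ n := by
  classical
  have h := hz.pow_sub_pow_eq_prod_sub_mul 1 x hn
  rw [one_pow] at h
  rw [h]
  refine Finset.prod_bij (fun j _ => z ^ (j : ℕ)) ?_ ?_ ?_ ?_
  · intro j _
    rw [Polynomial.mem_nthRootsFinset hn, ← pow_mul, mul_comm, pow_mul, hz.pow_eq_one, one_pow]
  · intro a _ b _ hab
    exact Fin.ext (hz.pow_inj a.2 b.2 hab)
  · intro b hb
    rw [Polynomial.mem_nthRootsFinset hn] at hb
    have : NeZero n := ⟨hn.ne'⟩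
    obtain ⟨i, hi, rfl⟩ := hz.eq_pow_of_pow_eq_one hb
    exact ⟨⟨i, hi⟩, Finset.mem_univ _, rfl⟩
  · intro j _
    ring

/-- Support of a multi-index. -/
def suppV {r : ℕ} {n : Fin r → ℕ} (v : ∀ i, Fin (n i)) : Finset (Fin r) :=
  Finset.univ.filter (fun i => (v i : ℕ) ≠ 0)

lemma prod_supp {r : ℕ} (n : Fin r → ℕ) (hn : ∀ i, 2 ≤ n i)
    (hpc : ∀ i j, i ≠ j → Nat.Coprime (n i) (n j))
    (z : Fin r → ℂ) (hz : ∀ i, IsPrimitiveRoot (z i) (n i)) (I : Finset (Fin r)) (x : ℂ) :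
    ∏ v : (∀ i, Fin (n i)) with suppV v ⊆ I, (1 - x * ∏ i, z i ^ (v i : ℕ))
      = 1 - x ^ (∏ i ∈ I, n i) := by
  induction I using Finset.induction_on generalizing x with
  | empty =>
    have : (Finset.univ.filter (fun v : (∀ i, Fin (n i)) => suppV v ⊆ ∅)) =
        {fun i => ⟨0, by have := hn i; omega⟩} := by
      ext v
      simp only [suppV, Finset.subset_empty, Finset.filter_eq_empty_iff, Finset.mem_filter,
        Finset.mem_univ, true_and, Finset.mem_singleton, funext_iff, Fin.ext_iff]
      simp
    rw [this]
    simp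
  | insert a I ha ih =>
    have h1 : ∏ v : (∀ i, Fin (n i)) with suppV v ⊆ insert a I, (1 - x * ∏ i, z i ^ (v i : ℕ))
        = ∏ p ∈ (Finset.univ : Finset (Fin (n a))) ×ˢ
            (Finset.univ.filter (fun v : (∀ i, Fin (n i)) => suppV v ⊆ I)),
            (1 - (x * z a ^ (p.1 : ℕ)) * ∏ i, z i ^ (p.2 i : ℕ)) := by
      refine Finset.prod_bij' (fun v _ => (v a, Function.update v a ⟨0, by have := hn a; omega⟩))
        (fun p _ => Function.update p.2 a p.1) ?_ ?_ ?_ ?_ ?_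
      · intro v hv
        simp only [suppV, Finset.subset_iff, Finset.mem_filter, Finset.mem_univ, true_and,
          Finset.mem_insert, Finset.mem_product] at hv ⊢
        intro i hi
        by_cases hia : i = a
        · subst hia; simp at hi
        · rw [Function.update_of_ne hia] at hi
          exact (hv hi).resolve_left hia
      · intro p hp
        simp only [suppV, Finset.subset_iff, Finset.mem_filter, Finset.mem_univ, true_and,
          Finset.mem_insert, Finset.mem_product] at hp ⊢
        intro i hi
        by_cases hia : i = a
        · exact Or.inl hia
        · rw [Function.update_of_ne hia] at hi
          exact Or.inr (hp hi)
      · intro v hv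
        simp
      · intro p hp
        simp only [suppV, Finset.subset_iff, Finset.mem_filter, Finset.mem_univ, true_and,
          Finset.mem_product] at hp
        have h0 : (p.2 a : ℕ) = 0 := by
          by_contra hc
          exact ha (hp hc)
        refine Prod.ext (by simp) ?_
        simp only [Function.update_idem]
        rw [Function.update_eq_self_iff]
        exact Fin.ext h0.symm
      · intro v hv
        congr 1
        rw [mul_assoc]
        congr 1
        rw [← Finset.mul_prod_erase _ _ (Finset.mem_univ a),
          ← Finset.mul_prod_erase (a := a) Finset.univ (fun i => z i ^
            ((Function.update v a ⟨0, by have := hn a; omega⟩ : ∀ i, Fin (n i)) i : ℕ))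
            (Finset.mem_univ a)]
        simp only [Function.update_self, pow_zero, one_mul]
        congr 1
        refine Finset.prod_congr rfl fun i hi => ?_
        rw [Function.update_of_ne (Finset.ne_of_mem_erase hi)]
    rw [h1, Finset.prod_product]
    simp only [ih]
    have hcop : Nat.Coprime (∏ i ∈ I, n i) (n a) :=
      Nat.Coprime.prod_left fun i hi => hpc i a (fun h => ha (h ▸ hi))
    have := prod_root (n a) (by have := hn a; omega) (z a ^ (∏ i ∈ I, n i))
      ((hz a).pow_of_coprime _ hcop) (x ^ (∏ i ∈ I, n i))
    rw [Finset.prod_insert ha, mul_comm, pow_mul, ← this]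
    refine Finset.prod_congr rfl fun j _ => ?_
    rw [mul_pow, ← pow_mul, ← pow_mul, mul_comm (j : ℕ)]

/-- **The function `Z_q` at a tuple of distinct torus type braids.** If the `n_i ≥ 2`
are pairwise coprime and `(∏_{i∈I} n_i, |∑_{i∈I} m_i|)` is coprime for every nonempty
`I ⊆ {1,…,r}`, then wherever all factors are nonzero,
`Z_q(s; σ_{n_1,m_1}, …, σ_{n_r,m_r}) = det(I − s·T_{n_1,m_1} ⊗ ⋯ ⊗ T_{n_r,m_r})⁻¹
  = ∏_{I ⊆ J ⊆ {1,…,r}} (1 − q^{|m(J)|·[n(I)]} s^{[n(I)]})^{(−1)^{|J|−|I|+1}}`. -/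
theorem Z_q_distinct_torus_braids (r : ℕ) (hr : 1 ≤ r)
    (n : Fin r → ℕ) (hn : ∀ i, 2 ≤ n i)
    (hpc : ∀ i j, i ≠ j → Nat.Coprime (n i) (n j))
    (m : Fin r → ℤ)
    (hcop : ∀ I : Finset (Fin r), I.Nonempty →
      Nat.Coprime (∏ i ∈ I, n i) (∑ i ∈ I, m i).natAbs)
    (q : ℂ) (hq : q ≠ 0) (s : ℂ)
    (hs : ∀ I J : Finset (Fin r), I ⊆ J →
      1 - q ^ ((∑ j ∈ J, m j) * ∏ i ∈ I, (n i : ℤ)) * s ^ (∏ i ∈ I, n i) ≠ 0) :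
    (((1 : Matrix (∀ i, Fin (n i)) (∀ i, Fin (n i)) ℂ)
        - s • torusKronecker n q m).det)⁻¹
      = ∏ J : Finset (Fin r), ∏ I ∈ J.powerset,
          (1 - q ^ ((∑ j ∈ J, m j) * ∏ i ∈ I, (n i : ℤ)) * s ^ (∏ i ∈ I, n i))
            ^ ((-1 : ℤ) ^ (J.card - I.card + 1)) := by
  have hn0 : ∀ i, n i ≠ 0 := fun i => by have := hn i; omega
  have hw : ∀ i, ∃ w : ℂ, IsPrimitiveRoot w (n i) :=
    fun i => ⟨_, Complex.isPrimitiveRoot_exp (n i) (hn0 i)⟩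
  choose w hw using hw
  have hw0 : ∀ i, w i ≠ 0 := fun i => (hw i).ne_zero (hn0 i)
  -- the root governing the eigenvalues of `T_{n i, m i}`
  set z : Fin r → ℂ := fun i => (w i ^ (m i))⁻¹ with hzdef
  have hz : ∀ i, IsPrimitiveRoot (z i) (n i) := by
    intro i
    have h := hcop {i} (Finset.singleton_nonempty i)
    rw [Finset.prod_singleton, Finset.sum_singleton] at h
    refine ((hw i).zpow_of_gcd_eq_one (m i) ?_).inv
    rw [Int.gcd_comm]
    simpa [Int.gcd] using h
  have hdet : (1 - s • torusKronecker n q m).det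
      = ∏ v : ∀ i, Fin (n i),
        (1 - (s * q ^ (∑ j ∈ suppV v, m j)) * ∏ i, z i ^ (v i : ℕ)) := by
    rw [show torusKronecker n q m = kronM (fun i => torusBurau (n i) q (m i)) from rfl,
      det_kron_conj _ (fun i => fourierM (n i) (w i)) (fun i => triM (n i) q (w i) ^ m i)
        (fun i => fourierM_det _ _ (hw i))
        (fun i => torus_conj (n i) (hn i) q (w i) hq (hw i) (m i)),
      det_kron_lower _ (fun i => (lower_zpow _ (triM_lower _ _ _)
        (triM_det _ _ _ hq (hw0 i)) (m i)).1)]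
    refine Finset.prod_congr rfl fun v _ => ?_
    rw [mul_assoc]
    congr 2
    have hqs : q ^ (∑ j ∈ suppV v, m j) = ∏ j ∈ suppV v, q ^ m j := by
      induction suppV v using Finset.induction_on with
      | empty => simp
      | insert a t ha ih => rw [Finset.sum_insert ha, Finset.prod_insert ha, zpow_add₀ hq, ih]
    rw [hqs, suppV, Finset.prod_filter, ← Finset.prod_mul_distrib]
    refine Finset.prod_congr rfl fun i _ => ?_
    rw [(lower_zpow _ (triM_lower _ _ _) (triM_det _ _ _ hq (hw0 i)) (m i)).2, triM_diag]
    by_cases h : (v i : ℕ) = 0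
    · simp [h]
    · rw [if_neg h, if_pos h, mul_zpow, hzdef]
      congr 1
      simp only [_root_.inv_zpow, inv_pow]
      rw [← zpow_natCast, ← zpow_natCast, ← _root_.zpow_mul, ← _root_.zpow_mul, mul_comm]
  rw [hdet, ← Finset.prod_fiberwise Finset.univ suppV, ← Finset.prod_inv_distrib]
  refine Finset.prod_congr rfl fun J _ => ?_
  set G : Finset (Fin r) → ℂ := fun K => ∏ v : (∀ i, Fin (n i)) with suppV v = K,
    (1 - (s * q ^ (∑ j ∈ J, m j)) * ∏ i, z i ^ (v i : ℕ)) with hG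
  have hF : ∀ I : Finset (Fin r), ∏ K ∈ I.powerset, G K =
      1 - q ^ ((∑ j ∈ J, m j) * ∏ i ∈ I, (n i : ℤ)) * s ^ (∏ i ∈ I, n i) := by
    intro I
    rw [hG, Finset.prod_fiberwise_eq_prod_filter]
    simp only [Finset.mem_powerset]
    rw [prod_supp n hn hpc z hz I, mul_pow, _root_.zpow_mul, mul_comm (s ^ _)]
    rw [← Nat.cast_prod, zpow_natCast]
  have hG0 : ∀ K ⊆ J, G K ≠ 0 := by
    intro K hK
    have h := hs J J (Finset.Subset.refl J)
    rw [← hF J, Finset.prod_ne_zero_iff] at h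
    exact h K (Finset.mem_powerset.mpr hK)
  have hM := mobius_prod J G hG0
  simp only [hF] at hM
  rw [hM, hG]
  congr 1
  refine Finset.prod_congr rfl fun v hv => ?_
  rw [(Finset.mem_filter.mp hv).2]
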